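/- Let T > 0 and d ≥ 1. Let ρ ∈ L¹((0,T) × ℝ^d) and J ∈ L¹((0,T) × ℝ^d; ℝ^d) satisfy ∂_t ρ + div_x J = 0 in the sense of distributions, i.e. ∫₀^T ∫_{ℝ^d} (ρ ∂_t ϕ + J · ∇_x ϕ) dx dt = 0 for every ϕ ∈ C_c^∞((0,T) × ℝ^d). Let φ ∈ C_c^∞(ℝ^d) be nonnegative with ∫ φ = 1 and support contained in the closed unit ball. Then for every h ∈ (0,T) and every δ > 0, ∫₀^{T−h} ∫_{ℝ^d} |ρ(t+h, x) − ρ(t, x)| dx dt ≤ 2 sup_{|y| ≤ δ} ∫₀^T ∫_{ℝ^d} |ρ(t, x − y) − ρ(t, x)| dx dt + (h/δ) ‖∇φ‖_{L¹(ℝ^d)} ‖J‖_{L¹((0,T) × ℝ^d)}. -/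

import Mathlib

open MeasureTheory
open scoped ENNReal RealInnerProductSpace

open scoped Pointwise in
lemma te_oneD {T h : ℝ} (hh : 0 < h) {g G : ℝ → ℝ}
    (hg : Integrable g) (hG : Integrable G)
    (H : ∀ η : ℝ → ℝ, ContDiff ℝ (⊤ : ℕ∞) η → HasCompactSupport η → tsupport η ⊆ Set.Ioo 0 T →
      ∫ t, (g t * deriv η t - G t * η t) = 0) :
    ∀ᵐ t, t ∈ Set.Ioo 0 (T - h) → g (t + h) - g t + ∫ s in Set.Ioc t (t + h), G s = 0 := by
  have hgh : Integrable (fun t => g (t + h)) := hg.comp_add_right h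
  have hGprim : Continuous (fun t => ∫ s in Set.Ioc t (t + h), G s) := by
    have h0 : Continuous (fun t => ∫ s in (0:ℝ)..t, G s) :=
      intervalIntegral.continuous_primitive (fun a b => hG.intervalIntegrable) 0
    have h1 : (fun t => ∫ s in Set.Ioc t (t + h), G s)
        = fun t => (∫ s in (0:ℝ)..(t+h), G s) - ∫ s in (0:ℝ)..t, G s := by
      funext t
      rw [intervalIntegral.integral_interval_sub_left hG.intervalIntegrable
        hG.intervalIntegrable, intervalIntegral.integral_of_le (by linarith)]
    rw [h1]
    exact (h0.comp (continuous_id.add continuous_const)).sub h0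
  refine isOpen_Ioo.ae_eq_zero_of_integral_contDiff_smul_eq_zero ?_ ?_
  · exact (((hgh.sub hg).locallyIntegrable).add hGprim.locallyIntegrable).locallyIntegrableOn _
  intro ψ hψ hψc hψs
  have hψcont : Continuous ψ := hψ.continuous
  have hψint : Integrable ψ := hψcont.integrable_of_hasCompactSupport hψc
  obtain ⟨C, hC⟩ := hψc.exists_bound_of_continuous hψcont
  set η : ℝ → ℝ := fun t => ∫ s in (t - h)..t, ψ s with hη
  have hΨ : ∀ t, HasDerivAt (fun u => ∫ s in (0:ℝ)..u, ψ s) (ψ t) t := fun t =>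
    intervalIntegral.integral_hasDerivAt_right hψint.intervalIntegrable
      (hψcont.stronglyMeasurableAtFilter _ _) hψcont.continuousAt
  have hηd : ∀ t, HasDerivAt η (ψ t - ψ (t - h)) t := by
    intro t
    have e : η = fun u => (∫ s in (0:ℝ)..u, ψ s) - ∫ s in (0:ℝ)..(u - h), ψ s := by
      funext u
      rw [intervalIntegral.integral_interval_sub_left hψint.intervalIntegrable
        hψint.intervalIntegrable]
    rw [e]
    refine (hΨ t).sub ?_
    exact (hΨ (t - h)).comp_sub_const t h
  have hderiv : deriv η = fun t => ψ t - ψ (t - h) := funext fun t => (hηd t).deriv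
  have hηsm : ContDiff ℝ (⊤ : ℕ∞) η := by
    rw [contDiff_infty_iff_deriv]
    refine ⟨fun t => (hηd t).differentiableAt, ?_⟩
    rw [hderiv]
    exact hψ.sub (hψ.comp (contDiff_id.sub contDiff_const))
  have hsub : Function.support η ⊆ tsupport ψ + Set.Icc 0 h := by
    intro t ht
    by_contra hcon
    apply ht
    refine intervalIntegral.integral_zero_ae (Filter.Eventually.of_forall fun s hs => ?_)
    rw [Set.uIoc_of_le (by linarith)] at hs
    by_contra hne
    exact hcon (Set.mem_add.2 ⟨s, subset_tsupport _ hne, t - s,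
      ⟨by linarith [hs.2], by linarith [hs.1]⟩, by ring⟩)
  have hcomp : IsCompact (tsupport ψ + Set.Icc 0 h) := IsCompact.add hψc isCompact_Icc
  have hsub2 : tsupport η ⊆ tsupport ψ + Set.Icc 0 h := closure_minimal hsub hcomp.isClosed
  have hηc : HasCompactSupport η := hcomp.of_isClosed_subset (isClosed_tsupport _) hsub2
  have hηs : tsupport η ⊆ Set.Ioo 0 T := by
    intro t ht
    obtain ⟨a, ha, b, hb, rfl⟩ := Set.mem_add.1 (hsub2 ht)
    have := hψs ha
    constructor
    · linarith [this.1, hb.1]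
    · linarith [this.2, hb.2]
  have key := H η hηsm hηc hηs
  obtain ⟨C', hC'⟩ := hηc.exists_bound_of_continuous hηsm.continuous
  have iGη : Integrable (fun t => G t * η t) :=
    hG.mul_bdd hηsm.continuous.aestronglyMeasurable (Filter.Eventually.of_forall hC')
  have igψ : Integrable (fun t => g t * ψ t) :=
    hg.mul_bdd hψcont.aestronglyMeasurable (Filter.Eventually.of_forall hC)
  have ighψ : Integrable (fun t => g (t + h) * ψ t) :=
    hgh.mul_bdd hψcont.aestronglyMeasurable (Filter.Eventually.of_forall hC)
  have igψh : Integrable (fun t => g t * ψ (t - h)) := by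
    have := ighψ.comp_sub_right h
    simpa using this
  have e1 : ∫ t, g t * ψ (t - h) = ∫ t, g (t + h) * ψ t := by
    have := integral_add_right_eq_self (μ := volume) (fun t => g t * ψ (t - h)) h
    rw [← this]
    simp
  -- Fubini
  set A : Set (ℝ × ℝ) := {p | p.2 < p.1 ∧ p.1 ≤ p.2 + h} with hA
  have hAm : MeasurableSet A := by
    apply MeasurableSet.inter
    · exact measurableSet_lt measurable_snd measurable_fst
    · exact measurableSet_le measurable_fst (measurable_snd.add_const h)
  have hF : Integrable (Function.uncurry fun t s => A.indicator (fun p => G p.1 * ψ p.2) (t, s))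
      (volume.prod volume) := (hG.mul_prod hψint).indicator hAm
  have e2 := integral_integral_swap hF
  have e3 : ∀ t, ∫ s, A.indicator (fun p => G p.1 * ψ p.2) (t, s) = G t * η t := by
    intro t
    have : (fun s => A.indicator (fun p => G p.1 * ψ p.2) (t, s))
        = (Set.Ico (t - h) t).indicator (fun s => G t * ψ s) := by
      funext s
      simp only [Set.indicator, hA, Set.mem_ofPred_eq, Set.mem_Ico]
      congr 1
      apply propext
      constructor
      · rintro ⟨a, b⟩; exact ⟨by linarith, a⟩
      · rintro ⟨a, b⟩; exact ⟨b, by linarith⟩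
    rw [this, integral_indicator measurableSet_Ico, integral_const_mul, integral_Ico_eq_integral_Ioc,
      ← intervalIntegral.integral_of_le (by linarith)]
  have e4 : ∀ s, ∫ t, A.indicator (fun p => G p.1 * ψ p.2) (t, s)
      = ψ s * ∫ t in Set.Ioc s (s + h), G t := by
    intro s
    have : (fun t => A.indicator (fun p => G p.1 * ψ p.2) (t, s))
        = (Set.Ioc s (s + h)).indicator (fun t => ψ s * G t) := by
      funext t
      simp only [Set.indicator, hA, Set.mem_ofPred_eq, Set.mem_Ioc, mul_comm]
    rw [this, integral_indicator measurableSet_Ioc, integral_const_mul]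
  simp_rw [e3, e4] at e2
  have iψG : Integrable (fun s => ψ s * ∫ t in Set.Ioc s (s + h), G t) := by
    have := hF.integral_prod_right
    simpa only [Function.uncurry, e4] using this
  have e5 : ∫ t, (g t * deriv η t - G t * η t)
      = (∫ t, g t * ψ t) - (∫ t, g t * ψ (t - h)) - ∫ t, G t * η t := by
    rw [← integral_sub igψ igψh, ← integral_sub (igψ.sub' igψh) iGη, hderiv]
    congr 1; funext t; simp only; ring
  have e6 : ∫ x, ψ x • (g (x + h) - g x + ∫ s in Set.Ioc x (x + h), G s)
      = (∫ t, g (t + h) * ψ t) - (∫ t, g t * ψ t) + ∫ s, ψ s * ∫ t in Set.Ioc s (s + h), G t := by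
    rw [← integral_sub ighψ igψ, ← integral_add (ighψ.sub' igψ) iψG]
    congr 1; funext t; simp only [smul_eq_mul]; ring
  rw [e6, ← e2]
  rw [e5, e1] at key
  linarith

section te
variable {E : Type*} [NormedAddCommGroup E] [NormedSpace ℝ E] [FiniteDimensional ℝ E]
  [MeasurableSpace E] [BorelSpace E] (μ : Measure E) [μ.IsAddHaarMeasure]

lemma te_mid {T h : ℝ} (hh : 0 < h) {R : ℝ × E → ℝ} {K : ℝ × E → E} {ψ : E → ℝ}
    (hRm : Measurable R) (hKm : Measurable K)
    (hR : Integrable R (volume.prod μ)) (hK : Integrable K (volume.prod μ))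
    (hψ : ContDiff ℝ (⊤ : ℕ∞) ψ) (hψc : HasCompactSupport ψ)
    (H : ∀ η : ℝ → ℝ, ContDiff ℝ (⊤ : ℕ∞) η → HasCompactSupport η → tsupport η ⊆ Set.Ioo 0 T →
      ∀ x : E, ∫ t, ∫ y, (R (t, y) * (deriv η t * ψ (x - y))
        - η t * fderiv ℝ ψ (x - y) (K (t, y))) ∂μ = 0) :
    ∫⁻ t in Set.Ioo 0 (T - h), ∫⁻ x, ‖(∫ y, R (t + h, y) * ψ (x - y) ∂μ)
        - ∫ y, R (t, y) * ψ (x - y) ∂μ‖ₑ ∂μ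
      ≤ ENNReal.ofReal h * (∫⁻ x, ‖fderiv ℝ ψ x‖ₑ ∂μ) * ∫⁻ t, ∫⁻ y, ‖K (t, y)‖ₑ ∂μ := by
  have hψcont : Continuous ψ := hψ.continuous
  have hdcont : Continuous (fderiv ℝ ψ) := hψ.continuous_fderiv (by simp)
  obtain ⟨C, hC⟩ := hψc.exists_bound_of_continuous hψcont
  obtain ⟨C', hC'⟩ := (hψc.fderiv ℝ).exists_bound_of_continuous hdcont
  -- joint measurability
  have hBm : StronglyMeasurable (fun p : ℝ × E => ∫ y, R (p.1, y) * ψ (p.2 - y) ∂μ) := by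
    apply StronglyMeasurable.integral_prod_right
    apply Measurable.stronglyMeasurable
    unfold Function.uncurry
    fun_prop
  have hdm : Measurable (fun q : E × ℝ × E => fderiv ℝ ψ (q.1 - q.2.2) (K q.2)) := by
    have h1 : Measurable (fun q : E × ℝ × E => (fderiv ℝ ψ (q.1 - q.2.2), K q.2)) := by
      refine Measurable.prodMk (hdcont.measurable.comp ?_) (hKm.comp measurable_snd)
      fun_prop
    exact (isBoundedBilinearMap_apply (𝕜 := ℝ) (E := E) (F := ℝ)).continuous.measurable.comp h1
  have intg : ∀ x, Integrable (fun p : ℝ × E => R p * ψ (x - p.2)) (volume.prod μ) := fun x =>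
    hR.mul_bdd (hψcont.comp (continuous_const.sub continuous_snd)).aestronglyMeasurable
      (Filter.Eventually.of_forall fun p => hC _)
  have intG : ∀ x, Integrable (fun p : ℝ × E => fderiv ℝ ψ (x - p.2) (K p)) (volume.prod μ) := by
    intro x
    refine (hK.norm.const_mul C').mono' ?_ (Filter.Eventually.of_forall fun p => ?_)
    · exact (hdm.comp (measurable_const.prodMk measurable_id)).aestronglyMeasurable
    · exact (ContinuousLinearMap.le_opNorm _ _).trans
        (mul_le_mul_of_nonneg_right (hC' _) (norm_nonneg _))
  -- pointwise in `x`
  have hx : ∀ x, ∫⁻ t in Set.Ioo 0 (T - h), ‖(∫ y, R (t + h, y) * ψ (x - y) ∂μ)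
        - ∫ y, R (t, y) * ψ (x - y) ∂μ‖ₑ
      ≤ ENNReal.ofReal h * ∫⁻ s, ∫⁻ y, ‖fderiv ℝ ψ (x - y)‖ₑ * ‖K (s, y)‖ₑ ∂μ := by
    intro x
    have h1 := te_oneD (T := T) hh (intg x).integral_prod_left (intG x).integral_prod_left (by
      intro η hη hηc hηs
      rw [← H η hη hηc hηs x]
      apply integral_congr_ae
      filter_upwards [(intg x).prod_right_ae, (intG x).prod_right_ae] with t ht1 ht2
      have : ∀ y, R (t, y) * (deriv η t * ψ (x - y)) - η t * fderiv ℝ ψ (x - y) (K (t, y))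
          = deriv η t * (R (t, y) * ψ (x - y)) - η t * fderiv ℝ ψ (x - y) (K (t, y)) := by
        intro y; ring
      simp_rw [this]
      rw [integral_sub (ht1.const_mul _) (ht2.const_mul _), integral_const_mul,
        integral_const_mul]
      ring)
    set G : ℝ → ℝ := fun s => ∫ y, fderiv ℝ ψ (x - y) (K (s, y)) ∂μ with hGdef
    have hGm : Measurable (fun s => ‖G s‖ₑ) := by
      apply Measurable.enorm
      apply StronglyMeasurable.measurable
      apply StronglyMeasurable.integral_prod_right
      exact (hdm.comp (measurable_const.prodMk measurable_id)).stronglyMeasurable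
    calc _ ≤ ∫⁻ t in Set.Ioo 0 (T - h), ∫⁻ s in Set.Ioc t (t + h), ‖G s‖ₑ := by
          apply lintegral_mono_ae
          rw [ae_restrict_iff' measurableSet_Ioo]
          filter_upwards [h1] with t ht htm
          have := ht htm
          rw [eq_neg_of_add_eq_zero_left this, enorm_neg]
          exact enorm_integral_le_lintegral_enorm _
      _ ≤ ∫⁻ t, ∫⁻ s in Set.Ioc t (t + h), ‖G s‖ₑ := setLIntegral_le_lintegral _ _
      _ = ∫⁻ t, ∫⁻ s, {p : ℝ × ℝ | p.1 < p.2 ∧ p.2 ≤ p.1 + h}.indicator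
            (fun p => ‖G p.2‖ₑ) (t, s) := by
          congr 1; funext t
          rw [← lintegral_indicator measurableSet_Ioc]
          rfl
      _ = ∫⁻ s, ∫⁻ t, {p : ℝ × ℝ | p.1 < p.2 ∧ p.2 ≤ p.1 + h}.indicator
            (fun p => ‖G p.2‖ₑ) (t, s) := by
          apply lintegral_lintegral_swap
          apply Measurable.aemeasurable
          apply Measurable.indicator (hGm.comp measurable_snd)
          apply MeasurableSet.inter
          · exact measurableSet_lt measurable_fst measurable_snd
          · exact measurableSet_le measurable_snd (measurable_fst.add_const h)
      _ = ∫⁻ s, ENNReal.ofReal h * ‖G s‖ₑ := by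
          congr 1; funext s
          have : (fun t => {p : ℝ × ℝ | p.1 < p.2 ∧ p.2 ≤ p.1 + h}.indicator
            (fun p => ‖G p.2‖ₑ) (t, s)) = (Set.Ico (s - h) s).indicator (fun _ => ‖G s‖ₑ) := by
            funext t
            simp only [Set.indicator, Set.mem_ofPred_eq, Set.mem_Ico]
            congr 1
            apply propext
            constructor
            · rintro ⟨a, b⟩; exact ⟨by linarith, a⟩
            · rintro ⟨a, b⟩; exact ⟨b, by linarith⟩
          rw [this, lintegral_indicator measurableSet_Ico, setLIntegral_const, Real.volume_Ico,
            mul_comm]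
          congr 2; ring
      _ = ENNReal.ofReal h * ∫⁻ s, ‖G s‖ₑ := lintegral_const_mul _ hGm
      _ ≤ _ := by
          gcongr with s
          refine (enorm_integral_le_lintegral_enorm _).trans ?_
          gcongr with y
          exact ContinuousLinearMap.le_opENorm _ _
  have hprod : Measurable (fun q : E × ℝ × E => ‖fderiv ℝ ψ (q.1 - q.2.2)‖ₑ * ‖K q.2‖ₑ) := by
    refine Measurable.mul (Measurable.enorm (hdcont.measurable.comp ?_))
      (hKm.comp measurable_snd).enorm
    fun_prop
  calc _ = ∫⁻ x, (∫⁻ t in Set.Ioo 0 (T - h), ‖(∫ y, R (t + h, y) * ψ (x - y) ∂μ)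
        - ∫ y, R (t, y) * ψ (x - y) ∂μ‖ₑ) ∂μ := by
        apply lintegral_lintegral_swap
        apply Measurable.aemeasurable
        apply Measurable.enorm
        refine Measurable.sub ?_ hBm.measurable
        exact hBm.measurable.comp ((measurable_fst.add_const h).prodMk measurable_snd)
    _ ≤ ∫⁻ x, (ENNReal.ofReal h * ∫⁻ s : ℝ, (∫⁻ y, ‖fderiv ℝ ψ (x - y)‖ₑ * ‖K (s, y)‖ₑ ∂μ)) ∂μ :=
        lintegral_mono hx
    _ = ∫⁻ x, ENNReal.ofReal h * ∫⁻ p, ‖fderiv ℝ ψ (x - p.2)‖ₑ * ‖K p‖ₑ ∂(volume.prod μ) ∂μ := by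
        congr 1; funext x; congr 1
        rw [lintegral_prod]
        exact (hprod.comp (measurable_const.prodMk measurable_id)).aemeasurable
    _ = ENNReal.ofReal h * ∫⁻ x, ∫⁻ p, ‖fderiv ℝ ψ (x - p.2)‖ₑ * ‖K p‖ₑ ∂(volume.prod μ) ∂μ := by
        apply lintegral_const_mul
        exact Measurable.lintegral_prod_right hprod
    _ = ENNReal.ofReal h * ∫⁻ p, ∫⁻ x, ‖fderiv ℝ ψ (x - p.2)‖ₑ * ‖K p‖ₑ ∂μ ∂(volume.prod μ) := by
        congr 1
        apply lintegral_lintegral_swap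
        exact hprod.aemeasurable
    _ = ENNReal.ofReal h * ∫⁻ p, (∫⁻ x, ‖fderiv ℝ ψ x‖ₑ ∂μ) * ‖K p‖ₑ ∂(volume.prod μ) := by
        congr 2; funext p
        rw [lintegral_mul_const]
        · rw [lintegral_sub_right_eq_self (fun x => ‖fderiv ℝ ψ x‖ₑ)]
        · exact (hdcont.measurable.comp (measurable_id.sub_const _)).enorm
    _ = _ := by
        rw [lintegral_const_mul _ hKm.enorm, lintegral_prod _ hKm.enorm.aemeasurable, mul_assoc]

lemma te_moll {S : ℝ≥0∞} {δ : ℝ} {R : ℝ × E → ℝ} {ψ : E → ℝ}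
    (hRm : Measurable R) (hR : Integrable R (volume.prod μ))
    (hψ : Continuous ψ) (hψc : HasCompactSupport ψ) (hψ0 : ∀ x, 0 ≤ ψ x)
    (hψ1 : ∫ x, ψ x ∂μ = 1) (hψs : ∀ x, ψ x ≠ 0 → x ∈ Metric.closedBall (0 : E) δ)
    (hS : ∀ y ∈ Metric.closedBall (0 : E) δ,
      ∫⁻ t, ∫⁻ x, ‖R (t, x - y) - R (t, x)‖ₑ ∂μ ≤ S) :
    ∫⁻ t, ∫⁻ x, ‖(∫ y, R (t, y) * ψ (x - y) ∂μ) - R (t, x)‖ₑ ∂μ ≤ S := by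
  obtain ⟨C, hC⟩ := hψc.exists_bound_of_continuous hψ
  have hψint : Integrable ψ μ := hψ.integrable_of_hasCompactSupport hψc
  have hψm : Measurable ψ := hψ.measurable
  calc _ ≤ ∫⁻ t, ∫⁻ x, ∫⁻ y, ‖R (t, x - y) - R (t, x)‖ₑ * ‖ψ y‖ₑ ∂μ ∂μ := by
        apply lintegral_mono_ae
        filter_upwards [hR.prod_right_ae] with t ht
        apply lintegral_mono
        intro x
        have e1 : ∫ y, R (t, y) * ψ (x - y) ∂μ = ∫ y, R (t, x - y) * ψ y ∂μ := by
          rw [← integral_sub_left_eq_self (fun y => R (t, y) * ψ (x - y)) μ x]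
          simp
        have i1 : Integrable (fun y => R (t, x - y) * ψ y) μ :=
          (ht.comp_sub_left x).mul_bdd hψ.aestronglyMeasurable (Filter.Eventually.of_forall hC)
        have e2 : R (t, x) = ∫ y, R (t, x) * ψ y ∂μ := by
          rw [integral_const_mul, hψ1, mul_one]
        have e3 : (∫ y, R (t, y) * ψ (x - y) ∂μ) - R (t, x)
            = ∫ y, (R (t, x - y) - R (t, x)) * ψ y ∂μ := by
          rw [e1]
          simp_rw [sub_mul]
          rw [integral_sub i1 (hψint.const_mul _), ← e2]
        simp only
        rw [e3]
        refine (enorm_integral_le_lintegral_enorm _).trans (le_of_eq ?_)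
        simp_rw [enorm_mul]
    _ = ∫⁻ p, ∫⁻ y, ‖R (p.1, p.2 - y) - R (p.1, p.2)‖ₑ * ‖ψ y‖ₑ ∂μ ∂(volume.prod μ) := by
        rw [lintegral_prod]
        apply Measurable.aemeasurable
        apply Measurable.lintegral_prod_right
        unfold Function.uncurry
        fun_prop
    _ = ∫⁻ y, ∫⁻ p, ‖R (p.1, p.2 - y) - R (p.1, p.2)‖ₑ * ‖ψ y‖ₑ ∂(volume.prod μ) ∂μ := by
        apply lintegral_lintegral_swap
        apply Measurable.aemeasurable
        unfold Function.uncurry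
        fun_prop
    _ ≤ ∫⁻ y, S * ‖ψ y‖ₑ ∂μ := by
        apply lintegral_mono
        intro y
        simp only
        rw [lintegral_mul_const _ (by fun_prop)]
        by_cases hy : ψ y = 0
        · simp [hy]
        · gcongr
          rw [lintegral_prod _ (by fun_prop)]
          exact hS y (hψs y hy)
    _ = S := by
        rw [lintegral_const_mul _ (by fun_prop)]
        have : ∫⁻ y, ‖ψ y‖ₑ ∂μ = 1 := by
          have h1 : ∀ y, ‖ψ y‖ₑ = ENNReal.ofReal (ψ y) := fun y => by
            rw [Real.enorm_eq_ofReal (hψ0 y)]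
          simp_rw [h1]
          rw [← ofReal_integral_eq_lintegral_ofReal hψint (Filter.Eventually.of_forall hψ0), hψ1]
          simp
        rw [this, mul_one]

lemma te_core {T h δ : ℝ} {S : ℝ≥0∞} (hh : 0 < h) {R : ℝ × E → ℝ} {K : ℝ × E → E} {ψ : E → ℝ}
    (hRm : Measurable R) (hKm : Measurable K)
    (hR : Integrable R (volume.prod μ)) (hK : Integrable K (volume.prod μ))
    (hψ : ContDiff ℝ (⊤ : ℕ∞) ψ) (hψc : HasCompactSupport ψ) (hψ0 : ∀ x, 0 ≤ ψ x)
    (hψ1 : ∫ x, ψ x ∂μ = 1) (hψs : ∀ x, ψ x ≠ 0 → x ∈ Metric.closedBall (0 : E) δ)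
    (hS : ∀ y ∈ Metric.closedBall (0 : E) δ,
      ∫⁻ t, ∫⁻ x, ‖R (t, x - y) - R (t, x)‖ₑ ∂μ ≤ S)
    (H : ∀ η : ℝ → ℝ, ContDiff ℝ (⊤ : ℕ∞) η → HasCompactSupport η → tsupport η ⊆ Set.Ioo 0 T →
      ∀ x : E, ∫ t, ∫ y, (R (t, y) * (deriv η t * ψ (x - y))
        - η t * fderiv ℝ ψ (x - y) (K (t, y))) ∂μ = 0) :
    ∫⁻ t in Set.Ioo 0 (T - h), ∫⁻ x, ‖R (t + h, x) - R (t, x)‖ₑ ∂μ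
      ≤ 2 * S + ENNReal.ofReal h * (∫⁻ x, ‖fderiv ℝ ψ x‖ₑ ∂μ) * ∫⁻ t, ∫⁻ y, ‖K (t, y)‖ₑ ∂μ := by
  have hmid := te_mid μ hh hRm hKm hR hK hψ hψc H
  have hmoll := te_moll μ hRm hR hψ.continuous hψc hψ0 hψ1 hψs hS
  have hBm : Measurable (fun p : ℝ × E => ∫ y, R (p.1, y) * ψ (p.2 - y) ∂μ) := by
    apply StronglyMeasurable.measurable
    apply StronglyMeasurable.integral_prod_right
    apply Measurable.stronglyMeasurable
    have := hψ.continuous.measurable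
    unfold Function.uncurry
    fun_prop
  set B : ℝ × E → ℝ := fun p => ∫ y, R (p.1, y) * ψ (p.2 - y) ∂μ with hB
  change ∫⁻ t in Set.Ioo 0 (T - h), ∫⁻ x, ‖B (t + h, x) - B (t, x)‖ₑ ∂μ ≤ _ at hmid
  change ∫⁻ t, ∫⁻ x, ‖B (t, x) - R (t, x)‖ₑ ∂μ ≤ S at hmoll
  have hM : Measurable (fun t => ∫⁻ x, ‖B (t, x) - R (t, x)‖ₑ ∂μ) := by
    apply Measurable.lintegral_prod_right
    unfold Function.uncurry
    fun_prop
  calc _ ≤ ∫⁻ t in Set.Ioo 0 (T - h), (((∫⁻ x, ‖B (t + h, x) - R (t + h, x)‖ₑ ∂μ)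
          + ∫⁻ x, ‖B (t, x) - R (t, x)‖ₑ ∂μ) + ∫⁻ x, ‖B (t + h, x) - B (t, x)‖ₑ ∂μ) := by
        apply lintegral_mono
        intro t
        simp only
        rw [← lintegral_add_left (by fun_prop), ← lintegral_add_left (by fun_prop)]
        apply lintegral_mono
        intro x
        have : R (t + h, x) - R (t, x) = (-(B (t + h, x) - R (t + h, x))
          + (B (t, x) - R (t, x))) + (B (t + h, x) - B (t, x)) := by ring
        simp only
        rw [this]
        refine (enorm_add_le _ _).trans ?_
        gcongr
        refine (enorm_add_le _ _).trans ?_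
        rw [enorm_neg]
    _ = (∫⁻ t in Set.Ioo 0 (T - h), ∫⁻ x, ‖B (t + h, x) - R (t + h, x)‖ₑ ∂μ)
          + (∫⁻ t in Set.Ioo 0 (T - h), ∫⁻ x, ‖B (t, x) - R (t, x)‖ₑ ∂μ)
          + ∫⁻ t in Set.Ioo 0 (T - h), ∫⁻ x, ‖B (t + h, x) - B (t, x)‖ₑ ∂μ := by
        have hM' : Measurable (fun t => ∫⁻ x, ‖B (t + h, x) - R (t + h, x)‖ₑ ∂μ) :=
          hM.comp (measurable_id.add_const h)
        rw [lintegral_add_left (by exact hM'.add hM), lintegral_add_left hM']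
    _ ≤ S + S + ENNReal.ofReal h * (∫⁻ x, ‖fderiv ℝ ψ x‖ₑ ∂μ)
          * ∫⁻ t, ∫⁻ y, ‖K (t, y)‖ₑ ∂μ := by
        refine add_le_add (add_le_add ?_ ?_) ?_
        · refine (setLIntegral_le_lintegral _ _).trans ?_
          rw [lintegral_add_right_eq_self (fun t => ∫⁻ x, ‖B (t, x) - R (t, x)‖ₑ ∂μ)]
          exact hmoll
        · exact (setLIntegral_le_lintegral _ _).trans hmoll
        · exact hmid
    _ = _ := by rw [two_mul]
end te

lemma te_rep {E F : Type*} [NormedAddCommGroup E] [MeasurableSpace E] (μ : Measure E) [SFinite μ]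
    [NormedAddCommGroup F] [MeasurableSpace F] [BorelSpace F]
    (T : ℝ) (f : ℝ → E → F)
    (hf : Integrable (fun p : ℝ × E => f p.1 p.2) ((volume.restrict (Set.Ioo 0 T)).prod μ)) :
    ∃ R : ℝ × E → F, Measurable R ∧ Integrable R (volume.prod μ) ∧
      (∀ᵐ t, t ∈ Set.Ioo 0 T → ∀ᵐ x ∂μ, f t x = R (t, x)) ∧
      ∀ t ∉ Set.Ioo 0 T, ∀ x, R (t, x) = 0 := by
  set I := Set.Ioo (0 : ℝ) T with hI
  have hIm : MeasurableSet (I ×ˢ (Set.univ : Set E)) := measurableSet_Ioo.prod MeasurableSet.univ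
  have hμ : (volume.restrict I).prod μ = (volume.prod μ).restrict (I ×ˢ Set.univ) := by
    rw [← Measure.prod_restrict, Measure.restrict_univ]
  refine ⟨(I ×ˢ Set.univ).indicator (hf.1.mk _), ?_, ?_, ?_, ?_⟩
  · exact hf.1.stronglyMeasurable_mk.measurable.indicator hIm
  · rw [integrable_indicator_iff hIm, IntegrableOn, ← hμ]
    exact hf.congr hf.1.ae_eq_mk
  · have h1 := Measure.ae_ae_of_ae_prod hf.1.ae_eq_mk
    rw [ae_restrict_iff' measurableSet_Ioo] at h1
    filter_upwards [h1] with t ht hti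
    filter_upwards [ht hti] with x hx
    rw [Set.indicator_of_mem (by exact ⟨hti, trivial⟩)]
    exact hx
  · intro t ht x
    exact Set.indicator_of_notMem (fun h => ht h.1) _

theorem time_equicontinuity (T : ℝ) (hT : 0 < T) (d : ℕ) (hd : 1 ≤ d)
    (ρ : ℝ → EuclideanSpace ℝ (Fin d) → ℝ)
    (J : ℝ → EuclideanSpace ℝ (Fin d) → EuclideanSpace ℝ (Fin d))
    (hρint : Integrable (fun p : ℝ × EuclideanSpace ℝ (Fin d) => ρ p.1 p.2)
      ((volume.restrict (Set.Ioo 0 T)).prod volume))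
    (hJint : Integrable (fun p : ℝ × EuclideanSpace ℝ (Fin d) => J p.1 p.2)
      ((volume.restrict (Set.Ioo 0 T)).prod volume))
    (hce : ∀ ϕ : ℝ → EuclideanSpace ℝ (Fin d) → ℝ,
      ContDiff ℝ (⊤ : ℕ∞) (fun p : ℝ × EuclideanSpace ℝ (Fin d) => ϕ p.1 p.2) →
      HasCompactSupport (fun p : ℝ × EuclideanSpace ℝ (Fin d) => ϕ p.1 p.2) →
      tsupport (fun p : ℝ × EuclideanSpace ℝ (Fin d) => ϕ p.1 p.2) ⊆
        Set.Ioo 0 T ×ˢ Set.univ →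
      (∫ t in Set.Ioo 0 T, ∫ x,
        (ρ t x * deriv (fun s => ϕ s x) t + ⟪J t x, gradient (fun z => ϕ t z) x⟫)) = 0)
    (φ : EuclideanSpace ℝ (Fin d) → ℝ)
    (hφsmooth : ContDiff ℝ (⊤ : ℕ∞) φ) (hφsupp : HasCompactSupport φ)
    (hφpos : ∀ x, 0 ≤ φ x) (hφmass : ∫ x, φ x = 1)
    (hφball : tsupport φ ⊆ Metric.closedBall 0 1)
    (h δ : ℝ) (hh : 0 < h) (hhT : h < T) (hδ : 0 < δ) :
    (∫⁻ t in Set.Ioo 0 (T - h), ∫⁻ x, ENNReal.ofReal |ρ (t + h) x - ρ t x|) ≤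
      2 * (⨆ y ∈ Metric.closedBall (0 : EuclideanSpace ℝ (Fin d)) δ,
          ∫⁻ t in Set.Ioo 0 T, ∫⁻ x, ENNReal.ofReal |ρ t (x - y) - ρ t x|) +
        ENNReal.ofReal ((h / δ) * (∫ x, ‖gradient φ x‖) *
          ∫ t in Set.Ioo 0 T, ∫ x, ‖J t x‖) := by
  obtain ⟨R, hRm, hR, hRρ, hR0⟩ := te_rep volume T ρ hρint
  obtain ⟨K, hKm, hK, hKJ, hK0⟩ := te_rep volume T J hJint
  set n := Module.finrank ℝ (EuclideanSpace ℝ (Fin d)) with hn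
  have hδ' : δ ≠ 0 := hδ.ne'
  set ψ : EuclideanSpace ℝ (Fin d) → ℝ := fun y => (δ ^ n)⁻¹ * φ (δ⁻¹ • y) with hψdef
  have hψsm : ContDiff ℝ (⊤ : ℕ∞) ψ :=
    contDiff_const.mul (hφsmooth.comp (contDiff_const_smul δ⁻¹))
  have hψc : HasCompactSupport ψ :=
    (hφsupp.comp_smul (inv_ne_zero hδ')).mul_left
  have hψ0 : ∀ x, 0 ≤ ψ x := fun x => mul_nonneg (by positivity) (hφpos _)
  have hψ1 : ∫ x, ψ x = 1 := by
    rw [hψdef, integral_const_mul, Measure.integral_comp_inv_smul_of_nonneg _ _ hδ.le, hφmass,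
      smul_eq_mul, mul_one, inv_mul_cancel₀ (by positivity)]
  have hψs : ∀ x, ψ x ≠ 0 → x ∈ Metric.closedBall (0 : EuclideanSpace ℝ (Fin d)) δ := by
    intro x hx
    have h1 : φ (δ⁻¹ • x) ≠ 0 := fun h0 => hx (by simp [hψdef, h0])
    have h2 := hφball (subset_tsupport _ h1)
    rw [mem_closedBall_zero_iff, norm_smul, norm_inv, Real.norm_of_nonneg hδ.le,
      inv_mul_le_iff₀ hδ, mul_one] at h2
    rwa [mem_closedBall_zero_iff]
  have hgradn : ∀ x, ‖gradient φ x‖ = ‖fderiv ℝ φ x‖ := by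
    intro x; rw [← toDual_gradient, LinearIsometryEquiv.norm_map]
  have hfd : ∀ x, fderiv ℝ ψ x = (δ ^ n)⁻¹ • δ⁻¹ • fderiv ℝ φ (δ⁻¹ • x) := by
    intro x
    rw [← fderiv_comp_smul]
    exact fderiv_const_mul ((hφsmooth.comp (contDiff_const_smul δ⁻¹)).differentiable (by simp) x) _
  have hdcont : Continuous (fderiv ℝ ψ) := hψsm.continuous_fderiv (by simp)
  have hL : ∫⁻ x, ‖fderiv ℝ ψ x‖ₑ = ENNReal.ofReal (δ⁻¹ * ∫ x, ‖gradient φ x‖) := by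
    rw [← ofReal_integral_norm_eq_lintegral_enorm
      (hdcont.integrable_of_hasCompactSupport (hψc.fderiv ℝ))]
    congr 1
    simp_rw [hfd, norm_smul, hgradn]
    rw [integral_const_mul, integral_const_mul,
      Measure.integral_comp_inv_smul_of_nonneg volume (fun x => ‖fderiv ℝ φ x‖) hδ.le,
      Real.norm_of_nonneg (by positivity), Real.norm_of_nonneg (by positivity), smul_eq_mul, ← hn]
    have : δ ^ n ≠ 0 := by positivity
    field_simp
  have hM : ∫⁻ t, ∫⁻ y, ‖K (t, y)‖ₑ = ENNReal.ofReal (∫ t in Set.Ioo 0 T, ∫ x, ‖J t x‖) := by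
    have e1 : ∫ t in Set.Ioo 0 T, ∫ x, ‖J t x‖ = ∫ t in Set.Ioo 0 T, ∫ x, ‖K (t, x)‖ := by
      apply integral_congr_ae
      rw [Filter.EventuallyEq, ae_restrict_iff' measurableSet_Ioo]
      filter_upwards [hKJ] with t ht hti
      apply integral_congr_ae
      filter_upwards [ht hti] with x hx
      rw [hx]
    rw [e1, setIntegral_eq_integral_of_forall_compl_eq_zero (fun t ht => by simp [hK0 t ht]),
      ← integral_prod _ hK.norm, ofReal_integral_norm_eq_lintegral_enorm hK,
      lintegral_prod _ hKm.enorm.aemeasurable]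
  have H : ∀ η : ℝ → ℝ, ContDiff ℝ (⊤ : ℕ∞) η → HasCompactSupport η → tsupport η ⊆ Set.Ioo 0 T →
      ∀ x, ∫ t, ∫ y, (R (t, y) * (deriv η t * ψ (x - y))
        - η t * fderiv ℝ ψ (x - y) (K (t, y))) = 0 := by
    intro η hη hηc hηs x
    have hsm : ContDiff ℝ (⊤ : ℕ∞) (fun p : ℝ × EuclideanSpace ℝ (Fin d) =>
        η p.1 * ψ (x - p.2)) :=
      (hη.comp contDiff_fst).mul (hψsm.comp (contDiff_const.sub contDiff_snd))
    have hcx : HasCompactSupport (fun y => ψ (x - y)) :=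
      hψc.comp_homeomorph (Homeomorph.subLeft x)
    have hsup : Function.support (fun p : ℝ × EuclideanSpace ℝ (Fin d) =>
        η p.1 * ψ (x - p.2)) ⊆ tsupport η ×ˢ tsupport (fun y => ψ (x - y)) := by
      intro p hp
      exact ⟨subset_tsupport _ (left_ne_zero_of_mul hp),
        subset_tsupport (fun y => ψ (x - y)) (right_ne_zero_of_mul hp)⟩
    have hts : tsupport (fun p : ℝ × EuclideanSpace ℝ (Fin d) =>
        η p.1 * ψ (x - p.2)) ⊆ tsupport η ×ˢ tsupport (fun y => ψ (x - y)) :=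
      closure_minimal hsup ((isClosed_tsupport _).prod (isClosed_tsupport _))
    have hcs : HasCompactSupport (fun p : ℝ × EuclideanSpace ℝ (Fin d) =>
        η p.1 * ψ (x - p.2)) :=
      (IsCompact.prod hηc hcx).of_isClosed_subset (isClosed_tsupport _) hts
    have key := hce (fun t y => η t * ψ (x - y)) hsm hcs
      (fun p hp => ⟨hηs (hts hp).1, trivial⟩)
    rw [← setIntegral_eq_integral_of_forall_compl_eq_zero (s := Set.Ioo 0 T)]
    · refine Eq.trans ?_ key
      apply integral_congr_ae
      rw [Filter.EventuallyEq, ae_restrict_iff' measurableSet_Ioo]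
      filter_upwards [hRρ, hKJ] with t ht1 ht2 hti
      apply integral_congr_ae
      filter_upwards [ht1 hti, ht2 hti] with y hy1 hy2
      have hd1 : deriv (fun s => η s * ψ (x - y)) t = deriv η t * ψ (x - y) :=
        deriv_mul_const (hη.differentiable (by simp) t) _
      have hd2 : fderiv ℝ (fun z => η t * ψ (x - z)) y = η t • -fderiv ℝ ψ (x - y) := by
        have hψd : HasFDerivAt ψ (fderiv ℝ ψ (x - y)) (x - y) :=
          (hψsm.differentiable (by simp) (x - y)).hasFDerivAt
        have h3 := (hψd.comp y ((hasFDerivAt_id y).const_sub x)).const_mul (η t)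
        refine Eq.trans h3.fderiv ?_
        ext v
        simp
      rw [real_inner_comm, inner_gradient_left, hd2, hd1, hy1, hy2]
      simp [sub_eq_add_neg]
    · intro t ht
      simp [hR0 t ht, hK0 t ht]
  set S := ⨆ y ∈ Metric.closedBall (0 : EuclideanSpace ℝ (Fin d)) δ,
          ∫⁻ t in Set.Ioo 0 T, ∫⁻ x, ENNReal.ofReal |ρ t (x - y) - ρ t x| with hSdef
  have hS : ∀ y ∈ Metric.closedBall (0 : EuclideanSpace ℝ (Fin d)) δ,
      ∫⁻ t, ∫⁻ x, ‖R (t, x - y) - R (t, x)‖ₑ ≤ S := by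
    intro y hy
    refine le_trans (le_of_eq ?_) (le_iSup₂ (f := fun y _ => ∫⁻ t in Set.Ioo 0 T, ∫⁻ x,
      ENNReal.ofReal |ρ t (x - y) - ρ t x|) y hy)
    have e1 : (fun t => ∫⁻ x, ‖R (t, x - y) - R (t, x)‖ₑ)
        = (Set.Ioo 0 T).indicator (fun t => ∫⁻ x, ‖R (t, x - y) - R (t, x)‖ₑ) := by
      funext t
      by_cases ht : t ∈ Set.Ioo 0 T
      · rw [Set.indicator_of_mem ht]
      · rw [Set.indicator_of_notMem ht]
        simp [hR0 t ht]
    rw [e1, lintegral_indicator measurableSet_Ioo]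
    apply lintegral_congr_ae
    rw [Filter.EventuallyEq, ae_restrict_iff' measurableSet_Ioo]
    filter_upwards [hRρ] with t ht hti
    apply lintegral_congr_ae
    filter_upwards [ht hti, (measurePreserving_sub_right volume y).quasiMeasurePreserving.ae
      (ht hti)] with x hx1 hx2
    rw [hx1, hx2, Real.enorm_eq_ofReal_abs]
  have core := te_core volume (T := T) hh hRm hKm hR hK hψsm hψc hψ0 hψ1 hψs hS H
  calc _ = ∫⁻ t in Set.Ioo 0 (T - h), ∫⁻ x, ‖R (t + h, x) - R (t, x)‖ₑ := by
        apply lintegral_congr_ae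
        rw [Filter.EventuallyEq, ae_restrict_iff' measurableSet_Ioo]
        filter_upwards [hRρ, (measurePreserving_add_right volume h).quasiMeasurePreserving.ae hRρ]
          with t ht1 ht2 hti
        apply lintegral_congr_ae
        filter_upwards [ht1 ⟨hti.1, by linarith [hti.2]⟩,
          ht2 ⟨by linarith [hti.1], by linarith [hti.2]⟩] with x hx1 hx2
        rw [hx1, hx2, Real.enorm_eq_ofReal_abs]
    _ ≤ _ := core
    _ = _ := by
        have g0 : 0 ≤ ∫ x, ‖gradient φ x‖ := integral_nonneg fun _ => norm_nonneg _
        rw [hL, hM, ← ENNReal.ofReal_mul hh.le, ← ENNReal.ofReal_mul (by positivity)]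
        congr 2
        rw [div_eq_mul_inv]
        ring
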